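/- arXiv:2312.01370 — 4 statements merged into one kernel-verified Lean document; each statement's English description precedes it below -/
import Mathlib

section
/- Let A ∈ ℂ^{m×n} and W ∈ ℂ^{n×m}. Then there exists a {1',2',3'}-inverse of A (i.e., the set A{1',2',3'} is nonempty) if and only if rank(WAW) = rank(A). -/
open Matrix

theorem exists_mul_eq_of_rank_mul_eq {K l m n : Type*} [Field K] [Fintype l] [Fintype m] [Fintype n]
    (A : Matrix l m K) (C : Matrix m n K) (h : (A * C).rank = A.rank) :
    ∃ Q : Matrix n m K, A * C * Q = A := by
  classical
  have hle : LinearMap.range (A * C).mulVecLin ≤ LinearMap.range A.mulVecLin := by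
    rw [mulVecLin_mul]
    exact LinearMap.range_comp_le_range _ _
  have hrange := Submodule.eq_of_le_of_finrank_eq hle h
  have hcol (j : m) : ∃ q : n → K, (A * C) *ᵥ q = A.col j := by
    have : A.col j ∈ LinearMap.range (A * C).mulVecLin := by
      rw [hrange]
      exact ⟨Pi.single j 1, by simp⟩
    exact this
  choose q hq using hcol
  refine ⟨.of fun i j => q j i, ?_⟩
  ext i j
  exact congrFun (hq j) i

theorem exists_mul_eq_of_rank_mul_eq' {K l m n : Type*} [Field K] [Fintype l] [Fintype m]
    [Fintype n] (C : Matrix l m K) (A : Matrix m n K) (h : (C * A).rank = A.rank) :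
    ∃ P : Matrix m l K, P * (C * A) = A := by
  obtain ⟨Q, hQ⟩ := exists_mul_eq_of_rank_mul_eq Aᵀ Cᵀ (by
    rw [← transpose_mul, rank_transpose, rank_transpose, h])
  refine ⟨Qᵀ, transpose_injective ?_⟩
  simpa [Matrix.mul_assoc] using hQ

open scoped ComplexOrder in
/-- Every complex matrix has a reflexive generalized inverse `X` with `B * X` Hermitian. -/
theorem exists_reflexive_inverse_isHermitian_mul {m n : Type*} [Fintype m] [Fintype n]
    (B : Matrix m n ℂ) :
    ∃ X : Matrix n m ℂ, B * X * B = B ∧ X * B * X = X ∧ (B * X).IsHermitian := by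
  obtain ⟨R, hR⟩ := exists_mul_eq_of_rank_mul_eq Bᴴ B (by
    rw [rank_conjTranspose_mul_self, rank_conjTranspose])
  have hBR : (B * R).IsHermitian := by
    have : (B * R)ᴴ * (B * R) = (B * R)ᴴ := by
      rw [conjTranspose_mul, Matrix.mul_assoc, ← Matrix.mul_assoc Bᴴ, hR]
    have h := isHermitian_conjTranspose_mul_self (B * R)
    rw [this] at h
    exact (conjTranspose_conjTranspose (B * R) ▸ h.eq).symm
  have hB : B * R * B = B := by
    rw [← hBR.eq, ← conjTranspose_inj, conjTranspose_mul, conjTranspose_conjTranspose,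
      ← Matrix.mul_assoc, hR]
  have hBX : B * (R * B * R) = B * R := by
    rw [← Matrix.mul_assoc, ← Matrix.mul_assoc, hB]
  refine ⟨R * B * R, by rw [hBX, hB], ?_, by rwa [hBX]⟩
  rw [Matrix.mul_assoc, hBX, Matrix.mul_assoc R B R, Matrix.mul_assoc, ← Matrix.mul_assoc (B * R),
    hB]

/-- `A` has a `{1',2',3'}`-inverse iff `rank (W * A * W) = rank A`. -/
theorem stmt0 (m n : ℕ) (A : Matrix (Fin m) (Fin n) ℂ) (W : Matrix (Fin n) (Fin m) ℂ) :
    (∃ X : Matrix (Fin m) (Fin n) ℂ,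
        A * W * X * W * A = A ∧
        X * W * A * W * X = X ∧
        (W * A * W * X)ᴴ = W * A * W * X) ↔
      (W * A * W).rank = A.rank := by
  have hWAW : (W * A * W).rank ≤ (W * A).rank := rank_mul_le_left _ _
  have hWA : (W * A).rank ≤ A.rank := rank_mul_le_right _ _
  constructor
  · rintro ⟨X, h1, h2, -⟩
    refine le_antisymm (hWAW.trans hWA) ?_
    calc A.rank = (A * W * (X * (W * A))).rank := by
          rw [← Matrix.mul_assoc, ← Matrix.mul_assoc, h1]
      _ ≤ (X * (W * A)).rank := rank_mul_le_right _ _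
      _ ≤ X.rank := rank_mul_le_left _ _
      _ = (X * (W * A * W) * X).rank := by
          rw [← Matrix.mul_assoc, ← Matrix.mul_assoc, h2]
      _ ≤ (X * (W * A * W)).rank := rank_mul_le_left _ _
      _ ≤ (W * A * W).rank := rank_mul_le_right _ _
  · intro h
    obtain ⟨P, hP⟩ := exists_mul_eq_of_rank_mul_eq' W A (le_antisymm hWA (h ▸ hWAW))
    obtain ⟨Q, hQ⟩ := exists_mul_eq_of_rank_mul_eq A W (le_antisymm (rank_mul_le_left _ _) (by
      rw [← h, Matrix.mul_assoc]
      exact rank_mul_le_right _ _))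
    obtain ⟨X, h1, h2, h3⟩ := exists_reflexive_inverse_isHermitian_mul (W * A * W)
    refine ⟨X, ?_, by simpa only [Matrix.mul_assoc] using h2, h3⟩
    calc A * W * X * W * A = P * (W * A) * W * X * W * (A * W * Q) := by rw [hP, hQ]
      _ = P * (W * A * W * X * (W * A * W)) * Q := by simp only [Matrix.mul_assoc]
      _ = P * (W * A) * W * Q := by rw [h1]; simp only [Matrix.mul_assoc]
      _ = A := by rw [hP, hQ]
end

section
/- Let A ∈ ℂ^{m×n} and W ∈ ℂ^{n×m} with rank(WAW) = rank(A), and let P be the Moore–Penrose inverse of WAW. Then X ∈ ℂ^{m×n} is a {1',2',3'}-inverse of A if and only if X = P + (I_m − P·WAW)·U·P for some U ∈ ℂ^{m×m}. -/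
open Matrix

/-- A product `A * B` of the same rank as `A` has the same column space as `A`. -/
theorem Matrix.exists_mul_mul_eq_left_of_rank_mul_eq {K l m n : Type*} [Field K] [Fintype l]
    [Fintype m] [Fintype n] [DecidableEq m] (A : Matrix l m K) (B : Matrix m n K)
    (h : (A * B).rank = A.rank) : ∃ Y : Matrix n m K, A * B * Y = A := by
  have hle : LinearMap.range (A * B).mulVecLin ≤ LinearMap.range A.mulVecLin := by
    rw [Matrix.mulVecLin_mul]
    exact LinearMap.range_comp_le_range _ _
  have heq := Submodule.eq_of_le_of_finrank_eq hle h
  have hcol (j : m) : ∃ y : n → K, (A * B) *ᵥ y = A *ᵥ Pi.single j 1 := by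
    have hmem : A.mulVecLin (Pi.single j 1) ∈ LinearMap.range (A * B).mulVecLin := by
      rw [heq]
      exact LinearMap.mem_range_self _ _
    exact hmem
  choose y hy using hcol
  refine ⟨Matrix.of fun i j => y j i, ?_⟩
  ext i j
  have hij := congrFun (hy j) i
  rw [Matrix.mulVec_single_one] at hij
  exact hij

/-- A product `B * A` of the same rank as `A` has the same row space as `A`. -/
theorem Matrix.exists_mul_mul_eq_right_of_rank_mul_eq {K l m n : Type*} [Field K] [Fintype l]
    [Fintype m] [Fintype n] [DecidableEq m] (A : Matrix m n K) (B : Matrix l m K)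
    (h : (B * A).rank = A.rank) : ∃ Z : Matrix m l K, Z * (B * A) = A := by
  obtain ⟨Y, hY⟩ := Matrix.exists_mul_mul_eq_left_of_rank_mul_eq Aᵀ Bᵀ (by
    rw [← Matrix.transpose_mul, Matrix.rank_transpose, Matrix.rank_transpose, h])
  refine ⟨Yᵀ, Matrix.transpose_injective ?_⟩
  rw [Matrix.transpose_mul, Matrix.transpose_mul, Matrix.transpose_transpose, hY]

/-- If `rank (W * A * W) = rank A`, then `A` factors through `W * A * W`, compatibly with both
one-sided products. -/
theorem Matrix.exists_factorization_of_rank_mul_mul_eq {K m n : Type*} [Field K] [Fintype m]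
    [Fintype n] [DecidableEq m] [DecidableEq n] (A : Matrix m n K) (W : Matrix n m K)
    (h : (W * A * W).rank = A.rank) :
    ∃ (Z : Matrix m n K) (Y : Matrix m n K),
      A * W = Z * (W * A * W) ∧ W * A = W * A * W * Y ∧ A = Z * (W * A * W) * Y := by
  have hAW : (A * W).rank = A.rank := by
    refine le_antisymm (Matrix.rank_mul_le_left A W) ?_
    rw [← h, Matrix.mul_assoc]
    exact Matrix.rank_mul_le_right W (A * W)
  have hWA : (W * A).rank = A.rank := by
    refine le_antisymm (Matrix.rank_mul_le_right W A) ?_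
    rw [← h]
    exact Matrix.rank_mul_le_left (W * A) W
  obtain ⟨Y, hY⟩ := Matrix.exists_mul_mul_eq_left_of_rank_mul_eq A W hAW
  obtain ⟨Z, hZ⟩ := Matrix.exists_mul_mul_eq_right_of_rank_mul_eq A W hWA
  have hZW : A * W = Z * (W * A * W) := by rw [← Matrix.mul_assoc, hZ]
  refine ⟨Z, Y, hZW, ?_, by rw [← hZW, hY]⟩
  rw [Matrix.mul_assoc W A W, Matrix.mul_assoc W, hY]

/-- Two `{1,3}`-inverses of `B` give the same product with `B`. -/
theorem Matrix.mul_eq_mul_of_isHermitian {R m n : Type*} [Ring R] [StarRing R] [Fintype m]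
    [Fintype n] {B : Matrix n m R} {X P : Matrix m n R} (hX : B * X * B = B)
    (hX' : (B * X)ᴴ = B * X) (hP : B * P * B = B) (hP' : (B * P)ᴴ = B * P) :
    B * X = B * P := by
  calc B * X = (B * P * (B * X))ᴴ := by rw [← Matrix.mul_assoc, hP, hX']
    _ = B * P := by rw [Matrix.conjTranspose_mul, hX', hP', ← Matrix.mul_assoc, hX]

/-- if `P` is the Moore–Penrose inverse of `W * A * W` and
`rank (W * A * W) = rank A`, then the `{1',2',3'}`-inverses of `A` are exactly the matrices
`P + (1 - P * (W * A * W)) * U * P`. -/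
theorem stmt3 (m n : ℕ) (A : Matrix (Fin m) (Fin n) ℂ) (W : Matrix (Fin n) (Fin m) ℂ)
    (P : Matrix (Fin m) (Fin n) ℂ)
    (hrank : (W * A * W).rank = A.rank)
    (hP1 : (W * A * W) * P * (W * A * W) = W * A * W)
    (hP2 : P * (W * A * W) * P = P)
    (hP3 : ((W * A * W) * P)ᴴ = (W * A * W) * P)
    (hP4 : (P * (W * A * W))ᴴ = P * (W * A * W))
    (X : Matrix (Fin m) (Fin n) ℂ) :
    (A * W * X * W * A = A ∧
      X * W * A * W * X = X ∧
      (W * A * W * X)ᴴ = W * A * W * X) ↔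
    ∃ U : Matrix (Fin m) (Fin m) ℂ,
      X = P + (1 - P * (W * A * W)) * U * P := by
  obtain ⟨Z, Y, hAW, hWA, hA⟩ := Matrix.exists_factorization_of_rank_mul_mul_eq A W hrank
  have hX2 : X * W * A * W * X = X * (W * A * W) * X := by simp only [Matrix.mul_assoc]
  rw [hX2]
  constructor
  · rintro ⟨h1, h2, h3⟩
    have hB : W * A * W * X * (W * A * W) = W * A * W := by
      calc W * A * W * X * (W * A * W) = W * (A * W * X * W * A) * W := by
            simp only [Matrix.mul_assoc]
        _ = W * A * W := by rw [h1]
    have hBX := Matrix.mul_eq_mul_of_isHermitian hB h3 hP1 hP3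
    generalize W * A * W = B at *
    refine ⟨X * B, ?_⟩
    have hXP : X * B * P = X := by rw [Matrix.mul_assoc, ← hBX, ← Matrix.mul_assoc, h2]
    rw [Matrix.mul_assoc, hXP, Matrix.sub_mul, Matrix.one_mul, Matrix.mul_assoc, hBX,
      ← Matrix.mul_assoc, hP2, add_sub_cancel]
  · rintro ⟨U, hX⟩
    have hBX : W * A * W * X = W * A * W * P := by
      rw [hX, Matrix.mul_add, ← Matrix.mul_assoc, ← Matrix.mul_assoc, Matrix.mul_sub,
        Matrix.mul_one, ← Matrix.mul_assoc, hP1, sub_self, Matrix.zero_mul, Matrix.zero_mul,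
        add_zero]
    refine ⟨?_, ?_, by rw [hBX, hP3]⟩
    · calc A * W * X * W * A = A * W * X * (W * A) := by rw [Matrix.mul_assoc _ W A]
        _ = Z * (W * A * W) * X * (W * A * W * Y) := by rw [← hAW, ← hWA]
        _ = Z * (W * A * W * X * (W * A * W)) * Y := by simp only [Matrix.mul_assoc]
        _ = A := by rw [hBX, hP1, ← hA]
    · have hP2' : P * (W * A * W * P) = P := by rw [← Matrix.mul_assoc, hP2]
      rw [Matrix.mul_assoc, hBX, hX, Matrix.add_mul, hP2', Matrix.mul_assoc _ P, hP2']
end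

section
/- Let A, X ∈ ℂ^{m×n} and W ∈ ℂ^{n×m}. The following are equivalent: (i) X is a {1',2',3'}-inverse of A; (ii) rank(WAW) = rank(A), XWAWX = X, and the null space of X equals the null space of (WA)*; (iii) rank(WAW) = rank(A), AWXWA = A, and the null space of X equals the null space of (WA)*. -/
open Matrix

theorem Matrix.mul_eq_zero_of_ker_le {k l n p : ℕ} {X : Matrix (Fin k) (Fin n) ℂ}
    {Y : Matrix (Fin l) (Fin n) ℂ} (h : LinearMap.ker X.mulVecLin ≤ LinearMap.ker Y.mulVecLin)
    {Z : Matrix (Fin n) (Fin p) ℂ} (hZ : X * Z = 0) : Y * Z = 0 := by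
  refine Matrix.toLin'.injective (LinearMap.ext fun v => ?_)
  have hv : Z *ᵥ v ∈ LinearMap.ker X.mulVecLin := by
    simp [LinearMap.mem_ker, Matrix.mulVec_mulVec, hZ]
  simpa [LinearMap.mem_ker, Matrix.mulVec_mulVec] using h hv

theorem Matrix.ker_mulVecLin_le_mul {k l n : ℕ} (B : Matrix (Fin l) (Fin k) ℂ)
    (Y : Matrix (Fin k) (Fin n) ℂ) :
    LinearMap.ker Y.mulVecLin ≤ LinearMap.ker (B * Y).mulVecLin := by
  rw [Matrix.mulVecLin_mul]
  exact LinearMap.ker_le_ker_comp _ _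

theorem Matrix.ker_mulVecLin_mul_eq {k l n : ℕ} {B : Matrix (Fin l) (Fin k) ℂ}
    {Y : Matrix (Fin k) (Fin n) ℂ} (h : Y.rank ≤ (B * Y).rank) :
    LinearMap.ker Y.mulVecLin = LinearMap.ker (B * Y).mulVecLin := by
  refine Submodule.eq_of_le_of_finrank_le (Matrix.ker_mulVecLin_le_mul B Y) ?_
  have h₁ := Y.mulVecLin.finrank_range_add_finrank_ker
  have h₂ := (B * Y).mulVecLin.finrank_range_add_finrank_ker
  unfold Matrix.rank at h
  omega

theorem Matrix.rank_eq_and_ker_eq_of_weighted_inverse {m n : ℕ}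
    {A X : Matrix (Fin m) (Fin n) ℂ} {W : Matrix (Fin n) (Fin m) ℂ}
    (h₁ : A * W * X * W * A = A) (h₂ : X * W * A * W * X = X)
    (h₃ : (W * A * W * X)ᴴ = W * A * W * X) :
    (W * A * W).rank = A.rank ∧
      LinearMap.ker X.mulVecLin = LinearMap.ker ((W * A)ᴴ).mulVecLin := by
  refine ⟨le_antisymm ?_ ?_, le_antisymm ?_ ?_⟩
  · exact (Matrix.rank_mul_le_left _ _).trans (Matrix.rank_mul_le_right _ _)
  · have hA : A = A * W * X * (W * A * W) * (X * W * A) := by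
      calc A = A * W * X * W * (A * W * X * W * A) := by rw [h₁, h₁]
        _ = _ := by simp only [Matrix.mul_assoc]
    conv_lhs => rw [hA]
    exact (Matrix.rank_mul_le_left _ _).trans (Matrix.rank_mul_le_right _ _)
  · have hWA : (W * A)ᴴ = (W * A)ᴴ * (W * A * W) * X := by
      calc (W * A)ᴴ = (W * (A * W * X * W * A))ᴴ := by rw [h₁]
        _ = ((W * A * W * X) * (W * A))ᴴ := by simp only [Matrix.mul_assoc]
        _ = _ := by rw [Matrix.conjTranspose_mul, h₃]; simp only [Matrix.mul_assoc]
    rw [hWA]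
    exact Matrix.ker_mulVecLin_le_mul _ X
  · have hX : X = X * (W * X)ᴴ * (W * A)ᴴ := by
      calc X = X * (W * A * W * X) := by
            conv_lhs => rw [← h₂]
            simp only [Matrix.mul_assoc]
        _ = X * ((W * A) * (W * X))ᴴ := by rw [← h₃]; simp only [Matrix.mul_assoc]
        _ = _ := by rw [Matrix.conjTranspose_mul, Matrix.mul_assoc]
    rw [hX]
    exact Matrix.ker_mulVecLin_le_mul _ _

theorem Matrix.weighted_inverse_of_rank_eq_of_ker_eq {m n : ℕ}
    {A X : Matrix (Fin m) (Fin n) ℂ} {W : Matrix (Fin n) (Fin m) ℂ}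
    (hr : (W * A * W).rank = A.rank) (h₂ : X * W * A * W * X = X)
    (hk : LinearMap.ker X.mulVecLin = LinearMap.ker ((W * A)ᴴ).mulVecLin) :
    A * W * X * W * A = A ∧ (W * A * W * X)ᴴ = W * A * W * X := by
  have hXP : X * (1 - W * A * W * X) = 0 := by
    rw [Matrix.mul_sub, Matrix.mul_one, sub_eq_zero]
    simpa only [Matrix.mul_assoc] using h₂.symm
  have hP : (W * A * W * X)ᴴ * (W * A) = W * A := by
    have h := congrArg Matrix.conjTranspose (Matrix.mul_eq_zero_of_ker_le hk.le hXP)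
    rw [Matrix.conjTranspose_mul, Matrix.conjTranspose_conjTranspose, Matrix.conjTranspose_sub,
      Matrix.conjTranspose_one, Matrix.conjTranspose_zero, Matrix.sub_mul, Matrix.one_mul,
      sub_eq_zero] at h
    exact h.symm
  have hPP : (W * A * W * X)ᴴ * (W * A * W * X) = W * A * W * X := by
    calc (W * A * W * X)ᴴ * (W * A * W * X)
        = (W * A * W * X)ᴴ * (W * A) * (W * X) := by simp only [Matrix.mul_assoc]
      _ = _ := by rw [hP]; simp only [Matrix.mul_assoc]
  have hH : (W * A * W * X)ᴴ = W * A * W * X := by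
    have h := congrArg Matrix.conjTranspose hPP
    rw [Matrix.conjTranspose_mul, Matrix.conjTranspose_conjTranspose, hPP] at h
    exact h.symm
  refine ⟨?_, hH⟩
  rw [hH] at hP
  have hker := Matrix.ker_mulVecLin_mul_eq (hr.symm.le.trans (Matrix.rank_mul_le_left (W * A) W))
  have h : W * A * (1 - W * X * W * A) = 0 := by
    rw [Matrix.mul_sub, Matrix.mul_one, sub_eq_zero]
    simpa only [Matrix.mul_assoc] using hP.symm
  have hA := Matrix.mul_eq_zero_of_ker_le hker.ge h
  rw [Matrix.mul_sub, Matrix.mul_one, sub_eq_zero] at hA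
  simpa only [Matrix.mul_assoc] using hA.symm

theorem Matrix.weighted_outer_of_inner_of_ker_eq {m n : ℕ}
    {A X : Matrix (Fin m) (Fin n) ℂ} {W : Matrix (Fin n) (Fin m) ℂ}
    (h₁ : A * W * X * W * A = A)
    (hk : LinearMap.ker X.mulVecLin = LinearMap.ker ((W * A)ᴴ).mulVecLin) :
    X * W * A * W * X = X := by
  have hP : W * A * W * X * (W * A) = W * A := by
    conv_rhs => rw [← h₁]
    simp only [Matrix.mul_assoc]
  open ComplexOrder in
  have hrX : X.rank = (W * A).rank := by
    rw [← Matrix.rank_conjTranspose (W * A)]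
    have e₁ := X.mulVecLin.finrank_range_add_finrank_ker
    have e₂ := ((W * A)ᴴ).mulVecLin.finrank_range_add_finrank_ker
    rw [hk] at e₁
    unfold Matrix.rank
    omega
  have hrP : X.rank ≤ (W * A * W * X).rank := by
    rw [hrX]
    conv_lhs => rw [← hP]
    exact Matrix.rank_mul_le_left _ _
  have h : W * A * W * X * (1 - W * A * W * X) = 0 := by
    rw [Matrix.mul_sub, Matrix.mul_one, sub_eq_zero]
    calc W * A * W * X = W * A * W * X * (W * A) * (W * X) := by
          rw [hP]; simp only [Matrix.mul_assoc]
      _ = _ := by simp only [Matrix.mul_assoc]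
  have hX := Matrix.mul_eq_zero_of_ker_le (Matrix.ker_mulVecLin_mul_eq hrP).ge h
  rw [Matrix.mul_sub, Matrix.mul_one, sub_eq_zero] at hX
  simpa only [Matrix.mul_assoc] using hX.symm

/-- characterizations of `{1',2',3'}`-inverses via rank, outer/inner
equations and null spaces. -/
theorem stmt4 (m n : ℕ) (A X : Matrix (Fin m) (Fin n) ℂ) (W : Matrix (Fin n) (Fin m) ℂ) :
    ((A * W * X * W * A = A ∧
        X * W * A * W * X = X ∧
        (W * A * W * X)ᴴ = W * A * W * X) ↔
      ((W * A * W).rank = A.rank ∧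
        X * W * A * W * X = X ∧
        LinearMap.ker X.mulVecLin = LinearMap.ker ((W * A)ᴴ).mulVecLin)) ∧
    (((W * A * W).rank = A.rank ∧
        X * W * A * W * X = X ∧
        LinearMap.ker X.mulVecLin = LinearMap.ker ((W * A)ᴴ).mulVecLin) ↔
      ((W * A * W).rank = A.rank ∧
        A * W * X * W * A = A ∧
        LinearMap.ker X.mulVecLin = LinearMap.ker ((W * A)ᴴ).mulVecLin)) := by
  refine ⟨⟨?_, ?_⟩, ?_, ?_⟩
  · rintro ⟨h₁, h₂, h₃⟩
    have h := Matrix.rank_eq_and_ker_eq_of_weighted_inverse h₁ h₂ h₃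
    exact ⟨h.1, h₂, h.2⟩
  · rintro ⟨hr, h₂, hk⟩
    have h := Matrix.weighted_inverse_of_rank_eq_of_ker_eq hr h₂ hk
    exact ⟨h.1, h₂, h.2⟩
  · rintro ⟨hr, h₂, hk⟩
    exact ⟨hr, (Matrix.weighted_inverse_of_rank_eq_of_ker_eq hr h₂ hk).1, hk⟩
  · rintro ⟨hr, h₁, hk⟩
    exact ⟨hr, Matrix.weighted_outer_of_inner_of_ker_eq h₁ hk, hk⟩
end

section
/- Let A ∈ ℂ^{m×n}, W ∈ ℂ^{n×m} with ind(A,W) ≤ 1 and rank(WAW) = rank(A). Then there is a unique X ∈ ℂ^{m×n} satisfying AWXWA = A, XWAWX = X, (WAWX)* = WAWX, and XW(AW)^2 = AW. -/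
open Matrix

/-- The index of a square complex matrix: the smallest nonnegative integer `k` with
`rank (M ^ k) = rank (M ^ (k + 1))`. -/
noncomputable def matIndex {p : ℕ} (M : Matrix (Fin p) (Fin p) ℂ) : ℕ :=
  sInf {k : ℕ | (M ^ k).rank = (M ^ (k + 1)).rank}

/-- The weighted index `ind(A, W) = max (ind (A * W)) (ind (W * A))`. -/
noncomputable def wIndex {m n : ℕ} (A : Matrix (Fin m) (Fin n) ℂ)
    (W : Matrix (Fin n) (Fin m) ℂ) : ℕ :=
  max (matIndex (A * W)) (matIndex (W * A))

theorem exists_eq_mul_mul_of_rank_mul_eq {l m n : ℕ} (B : Matrix (Fin l) (Fin m) ℂ)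
    (C : Matrix (Fin m) (Fin n) ℂ) (h : (B * C).rank = B.rank) :
    ∃ Y : Matrix (Fin n) (Fin m) ℂ, B = B * C * Y := by
  have hle : LinearMap.range (B * C).mulVecLin ≤ LinearMap.range B.mulVecLin := by
    rw [Matrix.mulVecLin_mul]
    exact LinearMap.range_comp_le_range _ _
  have heq := Submodule.eq_of_le_of_finrank_eq hle h
  have hcol : ∀ j, ∃ y, (B * C) *ᵥ y = B *ᵥ Pi.single j 1 := fun j => by
    have hj : B.mulVecLin (Pi.single j 1) ∈ LinearMap.range (B * C).mulVecLin :=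
      heq ▸ LinearMap.mem_range_self _ _
    exact hj
  choose y hy using hcol
  refine ⟨Matrix.of fun i j => y j i, ?_⟩
  ext i j
  have hij := congrFun (hy j) i
  rw [Matrix.mulVec_single_one] at hij
  exact hij.symm

theorem exists_eq_mul_mul_of_rank_mul_eq_right {l m n : ℕ} (B : Matrix (Fin l) (Fin m) ℂ)
    (C : Matrix (Fin m) (Fin n) ℂ) (h : (B * C).rank = C.rank) :
    ∃ Z : Matrix (Fin m) (Fin l) ℂ, C = Z * (B * C) := by
  obtain ⟨Y, hY⟩ := exists_eq_mul_mul_of_rank_mul_eq Cᵀ Bᵀ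
    (by rw [← Matrix.transpose_mul, Matrix.rank_transpose, Matrix.rank_transpose, h])
  refine ⟨Yᵀ, ?_⟩
  apply Matrix.transpose_injective
  rw [Matrix.transpose_mul, Matrix.transpose_mul, Matrix.transpose_transpose]
  exact hY

open scoped ComplexOrder in
/-- Every complex matrix has a reflexive inner inverse `G` for which `M * G` is Hermitian. -/
theorem exists_reflexive_inverse_isHermitian {m n : ℕ} (M : Matrix (Fin m) (Fin n) ℂ) :
    ∃ G : Matrix (Fin n) (Fin m) ℂ, M * G * M = M ∧ G * M * G = G ∧ (M * G)ᴴ = M * G := by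
  obtain ⟨G, hG⟩ := exists_eq_mul_mul_of_rank_mul_eq Mᴴ M
    (by rw [Matrix.rank_conjTranspose_mul_self, Matrix.rank_conjTranspose])
  have hM : (M * G)ᴴ * M = M := by
    have h := congrArg Matrix.conjTranspose hG
    simp only [Matrix.conjTranspose_mul, Matrix.conjTranspose_conjTranspose] at h ⊢
    rw [Matrix.mul_assoc]
    exact h.symm
  have hherm : (M * G)ᴴ = M * G := by
    have h : (M * G)ᴴ * (M * G) = M * G := by rw [← Matrix.mul_assoc, hM]
    have h' := congrArg Matrix.conjTranspose h
    rw [Matrix.conjTranspose_mul, Matrix.conjTranspose_conjTranspose, h] at h'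
    exact h'.symm
  rw [hherm] at hM
  refine ⟨G * M * G, ?_, ?_, ?_⟩
  · simp only [← Matrix.mul_assoc, hM]
  · calc G * M * G * M * (G * M * G) = G * (M * G * M) * G * M * G := by
          simp only [Matrix.mul_assoc]
      _ = G * M * G * M * G := by rw [hM]
      _ = G * (M * G * M) * G := by simp only [Matrix.mul_assoc]
      _ = G * M * G := by rw [hM]
  · simpa only [← Matrix.mul_assoc, hM] using hherm

theorem matIndex_spec {p : ℕ} (M : Matrix (Fin p) (Fin p) ℂ) :
    (M ^ matIndex M).rank = (M ^ (matIndex M + 1)).rank := by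
  refine Nat.sInf_mem (s := {k : ℕ | (M ^ k).rank = (M ^ (k + 1)).rank})
    ⟨Function.argmin fun k => (M ^ k).rank, ?_⟩
  refine le_antisymm (Function.argmin_le (fun k => (M ^ k).rank) _) ?_
  rw [pow_succ]
  exact Matrix.rank_mul_le_left _ _

theorem rank_mul_self_of_matIndex_le_one {p : ℕ} (M : Matrix (Fin p) (Fin p) ℂ)
    (h : matIndex M ≤ 1) : (M * M).rank = M.rank := by
  have hs := matIndex_spec M
  obtain h0 | h1 : matIndex M = 0 ∨ matIndex M = 1 := by omega
  · rw [h0, pow_zero, zero_add, pow_one] at hs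
    obtain ⟨Y, hY⟩ := exists_eq_mul_mul_of_rank_mul_eq 1 M (by rw [Matrix.one_mul, hs])
    rw [Matrix.one_mul] at hY
    refine le_antisymm (Matrix.rank_mul_le_left _ _) ?_
    calc M.rank = (M * M * Y).rank := by rw [Matrix.mul_assoc, ← hY, Matrix.mul_one]
      _ ≤ (M * M).rank := Matrix.rank_mul_le_left _ _
  · rw [h1, pow_one, pow_two] at hs
    exact hs.symm

/-- if `ind(A, W) ≤ 1` and `rank (W*A*W) = rank A`, there is a unique `X`
with `AWXWA = A`, `XWAWX = X`, `(WAWX)* = WAWX` and `XW(AW)^2 = AW`. -/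
theorem stmt9 (m n : ℕ) (A : Matrix (Fin m) (Fin n) ℂ) (W : Matrix (Fin n) (Fin m) ℂ)
    (hk : wIndex A W ≤ 1) (hrank : (W * A * W).rank = A.rank) :
    ∃! X : Matrix (Fin m) (Fin n) ℂ,
      A * W * X * W * A = A ∧
      X * W * A * W * X = X ∧
      (W * A * W * X)ᴴ = W * A * W * X ∧
      X * W * (A * W) ^ 2 = A * W := by
  have hWA : (W * A).rank = A.rank :=
    le_antisymm (Matrix.rank_mul_le_right _ _) (hrank ▸ Matrix.rank_mul_le_left _ _)
  have hsq := rank_mul_self_of_matIndex_le_one (W * A) ((le_max_right _ _).trans hk)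
  obtain ⟨Y, hY⟩ := exists_eq_mul_mul_of_rank_mul_eq (W * A) (W * A) hsq
  obtain ⟨Z, hZ⟩ := exists_eq_mul_mul_of_rank_mul_eq_right (W * A * W) A
    (by rw [Matrix.mul_assoc (W * A), hsq, hWA])
  obtain ⟨V, hV⟩ := exists_eq_mul_mul_of_rank_mul_eq_right W A hWA
  have hAY : A = A * W * A * Y := by
    calc A = V * (W * A) := hV
      _ = V * (W * A) * (W * A) * Y := by
          conv_lhs => rw [hY]
          simp only [Matrix.mul_assoc]
      _ = A * W * A * Y := by rw [← hV]; simp only [Matrix.mul_assoc]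
  refine existsUnique_of_exists_of_unique ?_ ?_
  · obtain ⟨G, hMGM, hGMG, hherm⟩ := exists_reflexive_inverse_isHermitian (W * A * W * A)
    have hAGM : A * G * (W * A * W * A) = A := by
      calc A * G * (W * A * W * A) = Z * (W * A * W * A * G * (W * A * W * A)) := by
            conv_lhs => enter [1, 1]; rw [hZ]
            simp only [Matrix.mul_assoc]
        _ = A := by rw [hMGM]; exact hZ.symm
    refine ⟨A * G, ?_, ?_, ?_, ?_⟩
    · calc A * W * (A * G) * W * A = A * W * (A * G * (W * A * W * A)) * Y := by
            conv_lhs => rw [Matrix.mul_assoc _ W A, hY]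
            simp only [Matrix.mul_assoc]
        _ = A := by rw [hAGM, ← hAY]
    · calc A * G * W * A * W * (A * G) = A * (G * (W * A * W * A) * G) := by
            simp only [Matrix.mul_assoc]
        _ = A * G := by rw [hGMG]
    · rw [← Matrix.mul_assoc]
      exact hherm
    · calc A * G * W * (A * W) ^ 2 = A * G * (W * A * W * A) * W := by
            simp only [pow_two, Matrix.mul_assoc]
        _ = A * W := by rw [hAGM]
  · have hrange : ∀ X : Matrix (Fin m) (Fin n) ℂ, X * W * A * W * X = X →
        X * W * (A * W) ^ 2 = A * W → X = A * (Y * W * X) := by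
      intro X h2 h4
      have hXA : X * W * A * W * A = A := by
        calc X * W * A * W * A = X * W * (A * W) ^ 2 * (A * Y) := by
              conv_lhs => enter [2]; rw [hAY]
              simp only [pow_two, Matrix.mul_assoc]
          _ = A := by rw [h4, ← Matrix.mul_assoc, ← hAY]
      calc X = X * (W * A) * W * X := by rw [← Matrix.mul_assoc X, h2]
        _ = X * W * A * W * A * Y * W * X := by
            conv_lhs => rw [hY]
            simp only [Matrix.mul_assoc]
        _ = A * (Y * W * X) := by rw [hXA]; simp only [Matrix.mul_assoc]
    have habsorb : ∀ X X' : Matrix (Fin m) (Fin n) ℂ, A * W * X * W * A = A →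
        W * A * W * X * (W * A * W * X') = W * A * W * X' := by
      intro X X' h1
      calc W * A * W * X * (W * A * W * X') = W * (A * W * X * W * A) * W * X' := by
            simp only [Matrix.mul_assoc]
        _ = W * A * W * X' := by rw [h1]
    rintro X X' ⟨h1, h2, h3, h4⟩ ⟨h1', h2', h3', h4'⟩
    have hproj : W * A * W * X = W * A * W * X' := by
      have h := congrArg Matrix.conjTranspose (habsorb X X' h1)
      rw [Matrix.conjTranspose_mul, h3, h3', habsorb X' X h1'] at h
      exact h
    have hcancel : ∀ K : Matrix (Fin n) (Fin n) ℂ, A * K = Z * (W * A * W * (A * K)) := by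
      intro K
      conv_lhs => rw [hZ]
      simp only [Matrix.mul_assoc]
    have hX := hrange X h2 h4
    have hX' := hrange X' h2' h4'
    calc X = Z * (W * A * W * X) := by rw [hX]; exact hcancel _
      _ = Z * (W * A * W * X') := by rw [hproj]
      _ = X' := by rw [hX']; exact (hcancel _).symm
end
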